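/- For every 𝒜 ∈ End(V) ⊗ S(𝔤) and every ℬ in the classical family algebra C_τ(𝔤), one has Σₖ ∂^k(𝒜)·(ℬ·(τ(Xₖ)⊗1) − (τ(Xₖ)⊗1)·ℬ) = {𝒜,ℬ}, where ∂^k acts on the S(𝔤)-component of 𝒜. -/

import Mathlib

open TensorProduct MvPolynomial

noncomputable section

/-- The bilinear map `(a, b) ↦ u * D₁ a * D₂ b` on polynomials. -/
def bil {n : ℕ} (u : MvPolynomial (Fin n) ℂ)
    (D₁ D₂ : MvPolynomial (Fin n) ℂ →ₗ[ℂ] MvPolynomial (Fin n) ℂ) :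
    MvPolynomial (Fin n) ℂ →ₗ[ℂ] MvPolynomial (Fin n) ℂ →ₗ[ℂ] MvPolynomial (Fin n) ℂ :=
  (((LinearMap.mul ℂ (MvPolynomial (Fin n) ℂ)).comp
      ((LinearMap.mulLeft ℂ u).comp D₁)).compl₂ D₂)

/-- The Poisson bracket `{a,b} = Σ c^k_{ij} X_k (∂^i a)(∂^j b)` on `S(𝔤)`. -/
def Pb {n : ℕ} (c : Fin n → Fin n → Fin n → ℂ) :
    MvPolynomial (Fin n) ℂ →ₗ[ℂ] MvPolynomial (Fin n) ℂ →ₗ[ℂ] MvPolynomial (Fin n) ℂ :=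
  ∑ i, ∑ j, ∑ k, c k i j •
    bil (X k) (pderiv i).toLinearMap (pderiv j).toLinearMap

/-- The noncommutative Poisson bracket on `End V ⊗ S(𝔤)`:
`{A ⊗ a, B ⊗ b} = AB ⊗ {a,b}`. -/
def Pnc {n : ℕ} (c : Fin n → Fin n → Fin n → ℂ) (V : Type*) [AddCommGroup V] [Module ℂ V] :
    (Module.End ℂ V ⊗[ℂ] MvPolynomial (Fin n) ℂ) →ₗ[ℂ]
      (Module.End ℂ V ⊗[ℂ] MvPolynomial (Fin n) ℂ) →ₗ[ℂ]
        (Module.End ℂ V ⊗[ℂ] MvPolynomial (Fin n) ℂ) :=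
  TensorProduct.map₂ (LinearMap.mul ℂ (Module.End ℂ V)) (Pb c)

/-- `A ↦ [f, A]` on `End V`. -/
def adE {V : Type*} [AddCommGroup V] [Module ℂ V] (f : Module.End ℂ V) :
    Module.End ℂ V →ₗ[ℂ] Module.End ℂ V :=
  LinearMap.mulLeft ℂ f - LinearMap.mulRight ℂ f

/-- The diagonal `𝔤`-action of the basis vector `X_l` on `End V ⊗ S(𝔤)`. -/
def Dact {n : ℕ} (c : Fin n → Fin n → Fin n → ℂ) {V : Type*} [AddCommGroup V] [Module ℂ V]
    (τ : Fin n → Module.End ℂ V) (l : Fin n) :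
    (Module.End ℂ V ⊗[ℂ] MvPolynomial (Fin n) ℂ) →ₗ[ℂ]
      (Module.End ℂ V ⊗[ℂ] MvPolynomial (Fin n) ℂ) :=
  LinearMap.rTensor _ (adE (τ l)) + LinearMap.lTensor _ (Pb c (X l))

theorem Pb_apply {n : ℕ} (c : Fin n → Fin n → Fin n → ℂ) (a b : MvPolynomial (Fin n) ℂ) :
    Pb c a b = ∑ i, ∑ j, ∑ k, c k i j • (X k * pderiv i a * pderiv j b) := by
  simp [Pb, bil, LinearMap.sum_apply]

/-- The Poisson bracket is determined by its values on the generators in the first argument. -/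
theorem sum_pderiv_mul_Pb_X {n : ℕ} (c : Fin n → Fin n → Fin n → ℂ)
    (a b : MvPolynomial (Fin n) ℂ) :
    ∑ l, pderiv l a * Pb c (X l) b = Pb c a b := by
  have hX (l : Fin n) : Pb c (X l) b = ∑ j, ∑ k, c k l j • (X k * pderiv j b) := by
    rw [Pb_apply, Finset.sum_eq_single l]
    · simp
    · intro i _ hi
      simp [pderiv_X_of_ne hi.symm]
    · simp
  simp only [hX, Pb_apply, Finset.mul_sum]
  refine Finset.sum_congr rfl fun i _ => Finset.sum_congr rfl fun j _ =>
    Finset.sum_congr rfl fun k _ => ?_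
  rw [mul_smul_comm]
  congr 1
  ring

theorem Pnc_eq_sum {n : ℕ} (c : Fin n → Fin n → Fin n → ℂ)
    {V : Type*} [AddCommGroup V] [Module ℂ V]
    (𝒜 ℬ : Module.End ℂ V ⊗[ℂ] MvPolynomial (Fin n) ℂ) :
    Pnc c V 𝒜 ℬ = ∑ l, LinearMap.lTensor (Module.End ℂ V) (pderiv l).toLinearMap 𝒜 *
      LinearMap.lTensor (Module.End ℂ V) (Pb c (X l)) ℬ := by
  induction 𝒜 with
  | zero => simp
  | add x y hx hy => simp only [map_add, LinearMap.add_apply, hx, hy, add_mul,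
      Finset.sum_add_distrib]
  | tmul A a =>
    induction ℬ with
    | zero => simp
    | add x y hx hy => simp only [map_add, hx, hy, mul_add, Finset.sum_add_distrib]
    | tmul B b =>
      simp [Pnc, ← sum_pderiv_mul_Pb_X c a b, TensorProduct.tmul_sum]

theorem rTensor_adE {V S : Type*} [AddCommGroup V] [Module ℂ V] [CommRing S] [Algebra ℂ S]
    (f : Module.End ℂ V) (ℬ : Module.End ℂ V ⊗[ℂ] S) :
    LinearMap.rTensor S (adE f) ℬ = (f ⊗ₜ[ℂ] (1 : S)) * ℬ - ℬ * (f ⊗ₜ[ℂ] (1 : S)) := by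
  induction ℬ with
  | zero => simp
  | add x y hx hy => rw [map_add, hx, hy, mul_add, add_mul]; abel
  | tmul B b => simp [adE]

/-- for `𝒜 ∈ End V ⊗ S(𝔤)` and `ℬ ∈ C_τ(𝔤)`,
`Σₖ ∂^k(𝒜)·(ℬ·(τ(Xₖ)⊗1) − (τ(Xₖ)⊗1)·ℬ) = {𝒜,ℬ}`. -/
theorem stmt17 {n : ℕ} (c : Fin n → Fin n → Fin n → ℂ)
    {V : Type*} [AddCommGroup V] [Module ℂ V] (τ : Fin n → Module.End ℂ V)
    (hskew : ∀ k i j, c k i j = - c k j i)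
    (hjac : ∀ i j l m, (∑ k, (c k i j * c m k l + c k j l * c m k i + c k l i * c m k j)) = 0)
    (hτ : ∀ i j, τ i * τ j - τ j * τ i = ∑ k, c k i j • τ k)
    (𝒜 ℬ : Module.End ℂ V ⊗[ℂ] MvPolynomial (Fin n) ℂ)
    (hℬ : ∀ l, Dact c τ l ℬ = 0) :
    ∑ k, (LinearMap.lTensor (Module.End ℂ V) (pderiv k).toLinearMap 𝒜) *
        (ℬ * ((τ k) ⊗ₜ[ℂ] (1 : MvPolynomial (Fin n) ℂ))
          - ((τ k) ⊗ₜ[ℂ] (1 : MvPolynomial (Fin n) ℂ)) * ℬ) =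
      Pnc c V 𝒜 ℬ := by
  rw [Pnc_eq_sum]
  refine Finset.sum_congr rfl fun k _ => ?_
  congr 1
  have h := hℬ k
  rw [Dact, LinearMap.add_apply, rTensor_adE] at h
  rw [← neg_sub, neg_eq_of_add_eq_zero_right h]

end
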